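/- arXiv:1603.06737 — 3 statements merged into one kernel-verified Lean document; each statement's English description precedes it below -/
import Mathlib

section
/- Let ω : [0,∞) → [0,∞) be nondecreasing, concave, with ω(0) = 0, and suppose ∫₀^σ ω(t)/t dt < ∞ for some σ > 0 (the Dini condition). Fix T > 0 and a constant ζ ∈ (0,1), and define φ(t) = Σ_{k=1}^∞ ω(ζᵏ t). Then φ(t) < ∞ for every t ∈ [0,T], and lim_{t→0⁺} φ(t) = 0. -/
open MeasureTheory Set Filter Topology


lemma dini_aux (ω : ℝ → ℝ)
    (hω_nonneg : ∀ t, 0 ≤ t → 0 ≤ ω t)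
    (hω_mono : MonotoneOn ω (Ici 0)) (hω0 : ω 0 = 0)
    (ζ : ℝ) (hζ : ζ ∈ Ioo (0:ℝ) 1) (s : ℝ) (hs : 0 ≤ s) :
    ENNReal.ofReal (1 - ζ) * (∑' k : ℕ, ENNReal.ofReal (ω (ζ ^ (k + 1) * s))) ≤
      ∫⁻ t in Ioc (0:ℝ) s, ENNReal.ofReal (ω t / t) := by
  obtain ⟨h0, h1⟩ := hζ
  rcases hs.eq_or_lt with rfl | hs
  · simp [hω0]
  have hanti : Antitone (fun k : ℕ => ζ ^ k * s) := by
    intro a b hab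
    exact mul_le_mul_of_nonneg_right (pow_le_pow_of_le_one h0.le h1.le hab) hs.le
  have hdisj : Pairwise (Function.onFun Disjoint
      (fun k : ℕ => Ioc (ζ ^ (k + 1) * s) (ζ ^ k * s))) := by
    have := hanti.pairwise_disjoint_on_Ioc_succ
    simpa using this
  have hsub : (⋃ k : ℕ, Ioc (ζ ^ (k + 1) * s) (ζ ^ k * s)) ⊆ Ioc 0 s := by
    refine iUnion_subset fun k x hx => ⟨lt_trans (by positivity) hx.1, hx.2.trans ?_⟩
    simpa using hanti (Nat.zero_le k)
  refine le_trans ?_ (lintegral_mono_set hsub)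
  rw [lintegral_iUnion (fun k => measurableSet_Ioc) hdisj, ← ENNReal.tsum_mul_left]
  refine ENNReal.tsum_le_tsum fun k => ?_
  have hp : 0 < ζ ^ k * s := by positivity
  have hp1 : 0 < ζ ^ (k + 1) * s := by positivity
  calc ENNReal.ofReal (1 - ζ) * ENNReal.ofReal (ω (ζ ^ (k + 1) * s))
      = ∫⁻ t in Ioc (ζ ^ (k + 1) * s) (ζ ^ k * s),
          ENNReal.ofReal (ω (ζ ^ (k + 1) * s) / (ζ ^ k * s)) := by
        rw [setLIntegral_const, Real.volume_Ioc, ← ENNReal.ofReal_mul (by linarith),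
          ← ENNReal.ofReal_mul (div_nonneg (hω_nonneg _ hp1.le) hp.le)]
        congr 1
        field_simp
        ring
    _ ≤ _ := by
        refine setLIntegral_mono' measurableSet_Ioc fun t ht => ENNReal.ofReal_le_ofReal ?_
        have ht0 : 0 < t := hp1.trans ht.1
        exact div_le_div₀ (hω_nonneg _ ht0.le) (hω_mono hp1.le ht0.le ht.1.le) ht0 ht.2

/-- **Dini condition implies finiteness and vanishing of φ.**
Let `ω : [0,∞) → [0,∞)` be nondecreasing, concave, `ω 0 = 0`, and satisfy the Dini
condition `∫₀^σ ω(t)/t dt < ∞` for some `σ > 0`.  Fix `T > 0`, `ζ ∈ (0,1)` and define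
`φ t = ∑_{k=1}^∞ ω (ζ^k t)` (a series in `ℝ≥0∞`).  Then `φ t < ∞` for every
`t ∈ [0,T]` and `φ t → 0` as `t → 0⁺`. -/
theorem dini_modulus_phi_finite_and_tendsto_zero
    (ω : ℝ → ℝ)
    (hω_nonneg : ∀ t, 0 ≤ t → 0 ≤ ω t)
    (hω_mono : MonotoneOn ω (Ici 0))
    (hω_conc : ConcaveOn ℝ (Ici 0) ω)
    (hω0 : ω 0 = 0)
    (hω_dini : ∃ σ > (0:ℝ), ∫⁻ t in Ioc (0:ℝ) σ, ENNReal.ofReal (ω t / t) < ⊤)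
    (T : ℝ) (hT : 0 < T) (ζ : ℝ) (hζ : ζ ∈ Ioo (0:ℝ) 1) :
    (∀ t ∈ Icc (0:ℝ) T, (∑' k : ℕ, ENNReal.ofReal (ω (ζ ^ (k + 1) * t))) < ⊤) ∧
      Tendsto (fun t : ℝ => ∑' k : ℕ, ENNReal.ofReal (ω (ζ ^ (k + 1) * t)))
        (nhdsWithin 0 (Ici 0)) (nhds 0) := by
  obtain ⟨σ, hσ, hfin⟩ := hω_dini
  have key := dini_aux ω hω_nonneg hω_mono hω0 ζ hζ
  have hc0 : ENNReal.ofReal (1 - ζ) ≠ 0 := by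
    simpa using hζ.2
  have hc : ENNReal.ofReal (1 - ζ) ≠ ⊤ := ENNReal.ofReal_ne_top
  constructor
  · intro t ht
    obtain ⟨n, hn⟩ : ∃ n : ℕ, ζ ^ n * t ≤ σ := by
      obtain ⟨n, hn⟩ := exists_pow_lt_of_lt_one (div_pos hσ hT) hζ.2
      refine ⟨n, ?_⟩
      have := (lt_div_iff₀ hT).1 hn
      have h2 := mul_le_mul_of_nonneg_left ht.2 (pow_nonneg hζ.1.le n)
      linarith
    rw [← Summable.sum_add_tsum_nat_add' (k := n) ENNReal.summable]
    refine ENNReal.add_lt_top.2 ⟨ENNReal.sum_lt_top.2 fun _ _ => ENNReal.ofReal_lt_top, ?_⟩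
    have h := (key (ζ ^ n * t) (mul_nonneg (pow_nonneg hζ.1.le n) ht.1)).trans
      (lintegral_mono_set (Ioc_subset_Ioc_right hn))
    have h3 := h.trans_lt hfin
    have h4 := ENNReal.lt_top_of_mul_ne_top_right h3.ne hc0
    convert h4 using 5 with k
    ring
  · have hlim : Tendsto (fun s : ℝ => (ENNReal.ofReal (1 - ζ))⁻¹ *
        ∫⁻ t in Ioc (0:ℝ) s, ENNReal.ofReal (ω t / t) ∂(volume.restrict (Ioc 0 σ)))
        (nhdsWithin 0 (Ici 0)) (nhds 0) := by
      have h1 : Tendsto (fun s : ℝ => (volume.restrict (Ioc 0 σ)) (Ioc (0:ℝ) s))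
          (nhdsWithin 0 (Ici 0)) (nhds 0) := by
        refine tendsto_of_tendsto_of_tendsto_of_le_of_le (g := fun _ => 0)
          (h := fun s : ℝ => ENNReal.ofReal s) tendsto_const_nhds ?_ (fun _ => zero_le) ?_
        · have : Tendsto (fun s : ℝ => ENNReal.ofReal s) (nhds 0) (nhds (ENNReal.ofReal 0)) :=
            (ENNReal.continuous_ofReal).tendsto 0
          rw [ENNReal.ofReal_zero] at this
          exact this.mono_left nhdsWithin_le_nhds
        · intro s
          refine (Measure.restrict_apply_le _ _).trans ?_
          simp
      have h2 := tendsto_setLIntegral_zero hfin.ne h1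
      simpa using ENNReal.Tendsto.const_mul h2 (Or.inr (ENNReal.inv_ne_top.2 hc0))
    refine tendsto_of_tendsto_of_tendsto_of_le_of_le' tendsto_const_nhds hlim
      (Eventually.of_forall fun _ => zero_le) ?_
    have hev : ∀ᶠ s : ℝ in nhdsWithin 0 (Ici 0), s ≤ σ :=
      nhdsWithin_le_nhds (Iic_mem_nhds hσ)
    filter_upwards [hev, self_mem_nhdsWithin] with s hs hs0
    rw [Measure.restrict_restrict measurableSet_Ioc,
      inter_eq_left.2 (Ioc_subset_Ioc_right hs)]
    rw [mul_comm, ← div_eq_mul_inv, ENNReal.le_div_iff_mul_le (Or.inl hc0) (Or.inl hc), mul_comm]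
    exact key s hs0
end

section
/- Under the model setup, fix h ∈ B̄(0,ε). There exists a family {R¹_h((x,y),·) : x,y ∈ X} of Borel measures on X² such that, setting C¹_h((x,y),·) = Q¹_h((x,y),·) + R¹_h((x,y),·): (i) for all Borel sets A, B ⊆ X the map (x,y) ↦ R¹_h((x,y),A×B) is measurable; (ii) each R¹_h((x,y),·) is a nonnegative measure; (iii) each C¹_h((x,y),·) is a probability measure on X²; (iv) for all Borel A, B ⊆ X and all x, y ∈ X, C¹_h((x,y),A×X) = Π_h(x,A) and C¹_h((x,y),X×B) = Π_h(y,B), i.e. C¹_h((x,y),·) is a coupling of Π_h(x,·) and Π_h(y,·). -/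
open MeasureTheory Set Filter Topology
open scoped ENNReal NNReal Classical

noncomputable section

/-- The measure `p(x,t)dt` on `[0,T]` (here `w = p x`). -/
def timeMeasure (T : ℝ) (w : ℝ → ℝ) : Measure ℝ :=
  (volume.restrict (Icc 0 T)).withDensity fun t => ENNReal.ofReal (w t)

/-- `T_h(x,t) = S(x,t) + h`, assumed (in the model) to lie in `X`; junk value `x` otherwise. -/
def Th {H : Type} [NormedAddCommGroup H] (X : Set H)
    (S : X → ℝ → X) (h : H) (x : X) (t : ℝ) : X :=
  if hm : ((S x t : H) + h) ∈ X then ⟨_, hm⟩ else x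

/-- Transition function `Π_h(x,A) = ∫₀^T 1_A(T_h(x,t)) p(x,t) dt`, as a measure. -/
def Pi1 {H : Type} [NormedAddCommGroup H] [MeasurableSpace H] (X : Set H)
    (S : X → ℝ → X) (p : X → ℝ → ℝ) (T : ℝ) (h : H) (x : X) : Measure X :=
  (timeMeasure T (p x)).map (Th X S h x)

/-- `n`-step transition function `Πⁿ_{h₁,…,hₙ}(x,·)` (the list records `h₁,…,hₙ`). -/
def PiN {H : Type} [NormedAddCommGroup H] [MeasurableSpace H] (X : Set H)
    (S : X → ℝ → X) (p : X → ℝ → ℝ) (T : ℝ) : List H → X → Measure X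
  | [], x => Measure.dirac x
  | h :: hs, x => (Pi1 X S p T h x).bind (PiN X S p T hs)

/-- Transition function `Π_ε(x,A) = ∫₀^T p(x,t) ν^ε(A − S(x,t)) dt`, as a measure. -/
def PiEps {H : Type} [NormedAddCommGroup H] [MeasurableSpace H] (X : Set H)
    (S : X → ℝ → X) (p : X → ℝ → ℝ) (T : ℝ) (ν : Measure H) (x : X) : Measure X :=
  ((timeMeasure T (p x)).prod ν).map fun th => Th X S th.2 x th.1

/-- The Markov operator `P_ε` on measures on `X`. -/
def PEps {H : Type} [NormedAddCommGroup H] [MeasurableSpace H] (X : Set H)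
    (S : X → ℝ → X) (p : X → ℝ → ℝ) (T : ℝ) (ν : Measure H) (μ : Measure X) : Measure X :=
  μ.bind (PiEps X S p T ν)

/-- Sub-probability transition function
`Q¹_h((x,y),·) = ∫₀^T min{p(x,t),p(y,t)} δ_{(T_h(x,t),T_h(y,t))} dt` on `X²`. -/
def Q1 {H : Type} [NormedAddCommGroup H] [MeasurableSpace H] (X : Set H)
    (S : X → ℝ → X) (p : X → ℝ → ℝ) (T : ℝ) (h : H) (z : X × X) : Measure (X × X) :=
  (timeMeasure T fun t => min (p z.1 t) (p z.2 t)).map fun t =>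
    (Th X S h z.1 t, Th X S h z.2 t)

/-- `n`-step sub-probability transition function `Qⁿ_{h₁,…,hₙ}((x,y),·)` on `X²`. -/
def QN {H : Type} [NormedAddCommGroup H] [MeasurableSpace H] (X : Set H)
    (S : X → ℝ → X) (p : X → ℝ → ℝ) (T : ℝ) : List H → X × X → Measure (X × X)
  | [], z => Measure.dirac z
  | h :: hs, z => (Q1 X S p T h z).bind (QN X S p T hs)

/-- `φ(b) = ∫_{X²} ρ(u,v) b(du×dv)` (in `ℝ≥0∞`). -/
def phiFun {α : Type} [MetricSpace α] [MeasurableSpace α] (b : Measure (α × α)) : ℝ≥0∞ :=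
  ∫⁻ z, ENNReal.ofReal (dist z.1 z.2) ∂b

/-- The Fortet–Mourier distance between two measures. -/
def FMdist {α : Type} [MetricSpace α] [MeasurableSpace α] (μ ν : Measure α) : ℝ :=
  sSup {r | ∃ f : α → ℝ, Continuous f ∧ (∀ z, |f z| ≤ 1) ∧ LipschitzWith 1 f ∧
    r = |∫ z, f z ∂μ - ∫ z, f z ∂ν|}

/-- `χ(x) = ∑_{i=0}^∞ ∫ g d(P_ε^i δ_x)`. -/
def chiFun {H : Type} [NormedAddCommGroup H] [MeasurableSpace H] (X : Set H)
    (S : X → ℝ → X) (p : X → ℝ → ℝ) (T : ℝ) (ν : Measure H) (g : X → ℝ) (x : X) : ℝ :=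
  ∑' i : ℕ, ∫ z, g z ∂((PEps X S p T ν)^[i] (Measure.dirac x))

end

theorem aux_meas {α β : Type} [MeasurableSpace α] [MeasurableSpace β] (T : ℝ)
    (w : α → ℝ → ℝ) (hw : Measurable (Function.uncurry w))
    (g : α → ℝ → β) (hg : Measurable (Function.uncurry g)) (A : Set β) (hA : MeasurableSet A) :
    Measurable fun z => (timeMeasure T (w z)).map (g z) A := by
  have hgz : ∀ z, Measurable (g z) := fun z => hg.comp measurable_prodMk_left
  have h1 : ∀ z, (timeMeasure T (w z)).map (g z) A =
      ∫⁻ t in Icc 0 T, (Function.uncurry g ⁻¹' A).indicator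
        (fun q => ENNReal.ofReal (Function.uncurry w q)) (z, t) := by
    intro z
    rw [Measure.map_apply (hgz z) hA, timeMeasure, withDensity_apply _ (hgz z hA),
      ← lintegral_indicator (hgz z hA)]
    rfl
  simp_rw [h1]
  exact Measurable.lintegral_prod_right' (hw.ennreal_ofReal.indicator (hg hA))

theorem aux_add (T : ℝ) (u v : ℝ → ℝ) (hu : Measurable u)
    (hu0 : ∀ t, 0 ≤ u t) (hv0 : ∀ t, 0 ≤ v t) :
    timeMeasure T (fun t => u t + v t) = timeMeasure T u + timeMeasure T v := by
  unfold timeMeasure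
  rw [← withDensity_add_left hu.ennreal_ofReal]
  congr 1
  ext t
  exact ENNReal.ofReal_add (hu0 t) (hv0 t)

theorem aux_prob (T : ℝ) (u : ℝ → ℝ) (hu0 : ∀ t, 0 ≤ u t)
    (h1 : ∫ t in Icc (0:ℝ) T, u t = 1) : timeMeasure T u univ = 1 := by
  unfold timeMeasure
  rw [withDensity_apply _ MeasurableSet.univ, Measure.restrict_univ,
    ← ofReal_integral_eq_lintegral_ofReal _ (Eventually.of_forall hu0), h1, ENNReal.ofReal_one]
  by_contra hn
  rw [integral_undef hn] at h1
  exact zero_ne_one h1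

/-- Existence of the coupling family: for fixed `h ∈ B̄(0,ε)` there is a
family `R¹_h((x,y),·)` of (nonnegative) Borel measures on `X²` such that
`C¹_h((x,y),·) := Q¹_h((x,y),·) + R¹_h((x,y),·)` is, for all `x,y`, a probability
measure coupling `Π_h(x,·)` and `Π_h(y,·)`, and `(x,y) ↦ R¹_h((x,y),A×B)` is
measurable for all Borel `A,B ⊆ X`. -/
theorem coupling_family_exists
    {H : Type} [NormedAddCommGroup H] [NormedSpace ℝ H]
    [SecondCountableTopology H] [CompleteSpace H]
    [MeasurableSpace H] [BorelSpace H]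
    (X : Set H) (hX : IsClosed X)
    (T εstar ε : ℝ) (hT : 0 < T) (hεs : 0 ≤ εstar) (hε : ε ∈ Icc 0 εstar)
    (p : X → ℝ → ℝ) (hp_meas : Measurable (Function.uncurry p))
    (hp_nonneg : ∀ x t, 0 ≤ p x t)
    (hp_norm : ∀ x : X, ∫ t in Icc (0:ℝ) T, p x t = 1)
    (S : X → ℝ → X) (hS_cont : Continuous (Function.uncurry S))
    (hstab : ∀ (x : X) (t : ℝ) (h : H), h ∈ Metric.closedBall (0:H) ε →
      ((S x t : H) + h) ∈ X)
    (h : H) (hh : h ∈ Metric.closedBall (0:H) ε) :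
    ∃ R : X → X → Measure (X × X),
      (∀ A B : Set X, MeasurableSet A → MeasurableSet B →
        Measurable fun z : X × X => R z.1 z.2 (A ×ˢ B)) ∧
      (∀ (x y : X) (A : Set (X × X)), 0 ≤ R x y A) ∧
      (∀ x y : X, IsProbabilityMeasure (Q1 X S p T h (x, y) + R x y)) ∧
      (∀ x y : X, (Q1 X S p T h (x, y) + R x y).map Prod.fst = Pi1 X S p T h x ∧
        (Q1 X S p T h (x, y) + R x y).map Prod.snd = Pi1 X S p T h y) := by
  have hTh_eq : ∀ x t, Th X S h x t = ⟨(S x t : H) + h, hstab x t h hh⟩ := fun x t =>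
    dif_pos (hstab x t h hh)
  have hTh : Measurable (Function.uncurry (Th X S h)) := by
    have : Function.uncurry (Th X S h) =
        fun q : X × ℝ => (⟨(S q.1 q.2 : H) + h, hstab q.1 q.2 h hh⟩ : X) := by
      ext q
      simp [Function.uncurry, hTh_eq]
    rw [this]
    refine Continuous.measurable (Continuous.subtype_mk ?_ _)
    exact (continuous_subtype_val.comp hS_cont).add continuous_const
  have hThx : ∀ x, Measurable (Th X S h x) := fun x => hTh.comp measurable_prodMk_left
  have hpx : ∀ x, Measurable (p x) := fun x => hp_meas.comp measurable_prodMk_left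
  let m : X × X → ℝ → ℝ := fun z t => min (p z.1 t) (p z.2 t)
  let a : X × X → ℝ → ℝ := fun z t => p z.1 t - m z t
  let b : X × X → ℝ → ℝ := fun z t => p z.2 t - m z t
  have h1 : Measurable fun q : (X × X) × ℝ => p q.1.1 q.2 :=
    hp_meas.comp ((measurable_fst.comp measurable_fst).prodMk measurable_snd)
  have h2 : Measurable fun q : (X × X) × ℝ => p q.1.2 q.2 :=
    hp_meas.comp ((measurable_snd.comp measurable_fst).prodMk measurable_snd)
  have hm : Measurable (Function.uncurry m) := h1.min h2
  have ha : Measurable (Function.uncurry a) := h1.sub hm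
  have hb : Measurable (Function.uncurry b) := h2.sub hm
  have hg1 : Measurable (Function.uncurry fun (z : X × X) t => Th X S h z.1 t) :=
    hTh.comp ((measurable_fst.comp measurable_fst).prodMk measurable_snd)
  have hg2 : Measurable (Function.uncurry fun (z : X × X) t => Th X S h z.2 t) :=
    hTh.comp ((measurable_snd.comp measurable_fst).prodMk measurable_snd)
  have hmz : ∀ z, Measurable (m z) := fun z => (hpx z.1).min (hpx z.2)
  have hm0 : ∀ z t, 0 ≤ m z t := fun z t => le_min (hp_nonneg _ _) (hp_nonneg _ _)
  have ha0 : ∀ z t, 0 ≤ a z t := fun z t => sub_nonneg.2 (min_le_left _ _)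
  have hb0 : ∀ z t, 0 ≤ b z t := fun z t => sub_nonneg.2 (min_le_right _ _)
  have hsa : ∀ z, timeMeasure T (p z.1) = timeMeasure T (m z) + timeMeasure T (a z) := by
    intro z
    rw [← aux_add T _ _ (hmz z) (hm0 z) (ha0 z)]
    congr 1
    ext t
    simp [a]
  have hsb : ∀ z, timeMeasure T (p z.2) = timeMeasure T (m z) + timeMeasure T (b z) := by
    intro z
    rw [← aux_add T _ _ (hmz z) (hm0 z) (hb0 z)]
    congr 1
    ext t
    simp [b]
  have hP : ∀ x, timeMeasure T (p x) univ = 1 := fun x =>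
    aux_prob T _ (hp_nonneg x) (hp_norm x)
  have hA1 : ∀ z, timeMeasure T (m z) univ + timeMeasure T (a z) univ = 1 := by
    intro z
    rw [← hP z.1, hsa z, Measure.add_apply]
  have hB1 : ∀ z, timeMeasure T (m z) univ + timeMeasure T (b z) univ = 1 := by
    intro z
    rw [← hP z.2, hsb z, Measure.add_apply]
  have hmt : ∀ z, timeMeasure T (m z) univ ≠ ⊤ := fun z hz => by
    have := hA1 z
    simp [hz] at this
  have hat : ∀ z, timeMeasure T (a z) univ ≠ ⊤ := fun z hz => by
    have := hA1 z
    simp [hz] at this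
  have hab : ∀ z, timeMeasure T (b z) univ = timeMeasure T (a z) univ := fun z =>
    (ENNReal.add_right_inj (hmt z)).1 ((hB1 z).trans (hA1 z).symm)
  have fina : ∀ z, IsFiniteMeasure (timeMeasure T (a z)) := fun z => ⟨(hat z).lt_top⟩
  have finb : ∀ z, IsFiniteMeasure (timeMeasure T (b z)) := fun z =>
    ⟨by rw [hab]; exact (hat z).lt_top⟩
  let R : X → X → Measure (X × X) := fun x y =>
    (timeMeasure T (a (x, y)) univ)⁻¹ •
      ((timeMeasure T (a (x, y))).map (Th X S h x)).prod
        ((timeMeasure T (b (x, y))).map (Th X S h y))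
  have hfst : ∀ x y, (Q1 X S p T h (x, y) + R x y).map Prod.fst = Pi1 X S p T h x := by
    intro x y
    rw [Measure.map_add _ _ measurable_fst, Pi1, hsa (x, y), Measure.map_add _ _ (hThx x)]
    congr 1
    · rw [Q1, Measure.map_map measurable_fst ((hThx x).prodMk (hThx y))]
      rfl
    · simp only [R]
      rw [Measure.map_smul, Measure.map_fst_prod, Measure.map_apply (hThx y) MeasurableSet.univ,
        preimage_univ, hab, smul_smul]
      by_cases h0 : timeMeasure T (a (x, y)) univ = 0
      · rw [Measure.measure_univ_eq_zero.1 h0]; simp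
      · rw [ENNReal.inv_mul_cancel h0 (hat _), one_smul]
  have hsnd : ∀ x y, (Q1 X S p T h (x, y) + R x y).map Prod.snd = Pi1 X S p T h y := by
    intro x y
    rw [Measure.map_add _ _ measurable_snd, Pi1, hsb (x, y), Measure.map_add _ _ (hThx y)]
    congr 1
    · rw [Q1, Measure.map_map measurable_snd ((hThx x).prodMk (hThx y))]
      rfl
    · simp only [R]
      rw [Measure.map_smul, Measure.map_snd_prod, Measure.map_apply (hThx x) MeasurableSet.univ,
        preimage_univ, smul_smul]
      by_cases h0 : timeMeasure T (a (x, y)) univ = 0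
      · rw [Measure.measure_univ_eq_zero.1 ((hab _).trans h0)]; simp
      · rw [ENNReal.inv_mul_cancel h0 (hat _), one_smul]
  refine ⟨R, ?_, fun _ _ _ => zero_le, ?_, fun x y => ⟨hfst x y, hsnd x y⟩⟩
  · intro A B hA hB
    have e : (fun z : X × X => R z.1 z.2 (A ×ˢ B)) = fun z =>
        ((timeMeasure T (a z)).map (Th X S h z.1) univ)⁻¹ *
        ((timeMeasure T (a z)).map (Th X S h z.1) A *
          (timeMeasure T (b z)).map (Th X S h z.2) B) := by
      ext z
      simp only [R]
      rw [Measure.smul_apply, Measure.prod_prod, smul_eq_mul,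
        Measure.map_apply (hThx z.1) MeasurableSet.univ, preimage_univ]
    rw [e]
    exact (aux_meas T a ha _ hg1 _ MeasurableSet.univ).inv.mul
      ((aux_meas T a ha _ hg1 _ hA).mul (aux_meas T b hb _ hg2 _ hB))
  · intro x y
    constructor
    have := congrArg (fun μ => μ univ) (hfst x y)
    simp only [Pi1] at this
    rw [Measure.map_apply measurable_fst MeasurableSet.univ,
      Measure.map_apply (hThx x) MeasurableSet.univ, preimage_univ, preimage_univ, hP] at this
    exact this
end

section
/- Let (X,ρ) be a Polish space, x̄ ∈ X, V(x) = ρ(x,x̄) and V̄(x,y) = V(x)+V(y). Let Λ₁ ∈ [0,1) and c ∈ (0,∞), fix ϰ ∈ (0, 1−Λ₁), and set K_ϰ = {(x,y) ∈ X² : V̄(x,y) < 2c/ϰ}. Let (Ω,F,P) be a probability space with filtration (F_n)_{n≥0}, and let Ψ = (Ψ_n)_{n≥0} be an (F_n)-adapted X²-valued process such that Ψ₀ = (x₀,y₀) almost surely, V̄(Ψ_n) is integrable for every n, and the drift condition E(V̄(Ψ_{n+1}) | F_n) ≤ Λ₁ V̄(Ψ_n) + 2c holds almost surely for every n ≥ 0.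 Let d = inf{n ≥ 1 : Ψ_n ∈ K_ϰ} (with d = ∞ if no such n exists). Then for every ζ ∈ (0,1) there exist constants C₁, C₂ > 0, depending only on Λ₁, ϰ, ζ and c, such that E((Λ₁+ϰ)^{−ζ d}) ≤ C₁ V̄(x₀,y₀) + C₂; in particular d < ∞ almost surely. -/
open MeasureTheory Set Filter Topology
open scoped ENNReal NNReal Classical

noncomputable section

/-- The first hitting time (at times `n ≥ 1`) of the set `K` by the process `Ψ`,
with value `⊤` if `K` is never visited. -/
def hitTime {Ω E : Type} (K : Set (E × E)) (Ψ : ℕ → Ω → E × E) (ωp : Ω) : ℕ∞ :=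
  sInf {n : ℕ∞ | ∃ m : ℕ, n = (m : ℕ∞) ∧ 1 ≤ m ∧ Ψ m ωp ∈ K}

/-- `geomVal β ζ N = β^(−ζN)`, with value `⊤` for `N = ∞` (for `0 < β < 1`). -/
def geomVal (β ζ : ℝ) : ℕ∞ → ℝ≥0∞ :=
  fun N => N.recTopCoe ⊤ fun n : ℕ => ENNReal.ofReal (β ^ (-(ζ * (n : ℝ))))

theorem aux_tail {Ω : Type} {mΩ : MeasurableSpace Ω} (P : Measure Ω) [IsProbabilityMeasure P]
    (ℱ : Filtration ℕ mΩ) (V : ℕ → Ω → ℝ) (L c κ v0 : ℝ) (hL : 0 ≤ L) (hL1 : L < 1) (hc : 0 < c)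
    (hκ : 0 < κ)
    (hV0 : ∀ n ω, 0 ≤ V n ω) (hm : ∀ n, Measurable[ℱ n] (V n)) (h0 : ∀ᵐ ω ∂P, V 0 ω = v0)
    (hI : ∀ n, Integrable (V n) P)
    (hd : ∀ n, ∀ᵐ ω ∂P, (P[V (n+1) | ℱ n]) ω ≤ L * V n ω + 2 * c) (n : ℕ) :
    P {ω | ∀ k, 1 ≤ k → k ≤ n + 1 → 2 * c / κ ≤ V k ω}
      ≤ ENNReal.ofReal (κ / (2 * c) * ((L + κ) ^ n * (v0 + 2 * c))) := by
  set A : ℕ → Set Ω := fun n => {ω | ∀ k, 1 ≤ k → k ≤ n → 2 * c / κ ≤ V k ω} with hA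
  have hAm : ∀ n, MeasurableSet[ℱ n] (A n) := by
    intro n
    have : A n = ⋂ k, ⋂ (_ : 1 ≤ k), ⋂ (_ : k ≤ n), {ω | 2 * c / κ ≤ V k ω} := by
      ext ω; simp [hA]
    rw [this]
    refine MeasurableSet.iInter fun k => MeasurableSet.iInter fun _ => MeasurableSet.iInter fun hk => ?_
    exact ℱ.mono hk _ (measurableSet_le (@measurable_const _ _ _ (ℱ k) _) (hm k))
  have hAm' : ∀ n, MeasurableSet (A n) := fun n => ℱ.le n _ (hAm n)
  have hstep : ∀ n, ∫ ω in A n, V (n+1) ω ∂P ≤ ∫ ω in A n, (L * V n ω + 2 * c) ∂P := by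
    intro n
    rw [← setIntegral_condExp (ℱ.le n) (hI (n+1)) (hAm n)]
    refine setIntegral_mono_ae integrable_condExp.integrableOn ?_ (hd n)
    exact (((hI n).const_mul L).add (integrable_const _)).integrableOn
  have hsub : ∀ n, ∫ ω in A (n+1), V (n+1) ω ∂P ≤ ∫ ω in A n, V (n+1) ω ∂P := by
    intro n
    refine setIntegral_mono_set (hI (n+1)).integrableOn (Eventually.of_forall fun ω => hV0 _ _) ?_
    exact Eventually.of_forall fun ω hω k h1 h2 => hω k h1 (by omega)
  have hv0 : 0 ≤ v0 := by
    obtain ⟨ω, hω⟩ := h0.exists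
    exact hω ▸ hV0 0 ω
  have key : ∀ n, ∫ ω in A (n+1), V (n+1) ω ∂P ≤ (L + κ) ^ n * (v0 + 2 * c) := by
    intro n
    induction n with
    | zero =>
      refine (hsub 0).trans ((hstep 0).trans ?_)
      have hA0 : A 0 = univ := by
        ext ω; simp only [hA, mem_ofPred_eq, mem_univ, iff_true]; intro k h1 h2; omega
      have : ∫ ω in A 0, (L * V 0 ω + 2 * c) ∂P = ∫ ω, (L * v0 + 2 * c) ∂P := by
        rw [hA0, setIntegral_univ]
        refine integral_congr_ae ?_
        filter_upwards [h0] with ω hω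
        rw [hω]
      rw [this]
      simp
      nlinarith
    | succ n ih =>
      refine (hsub (n+1)).trans ((hstep (n+1)).trans ?_)
      have : ∫ ω in A (n+1), (L * V (n+1) ω + 2 * c) ∂P ≤ ∫ ω in A (n+1), (L + κ) * V (n+1) ω ∂P := by
        refine setIntegral_mono_on ?_ ((hI _).const_mul _).integrableOn (hAm' _) ?_
        · exact (((hI _).const_mul L).add (integrable_const _)).integrableOn
        · intro ω hω
          have := hω (n+1) (by omega) le_rfl
          rw [div_le_iff₀ hκ] at this
          linarith
      refine this.trans ?_
      rw [integral_const_mul, pow_succ]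
      have := mul_le_mul_of_nonneg_left ih (by linarith : 0 ≤ L + κ)
      linarith
  have hmk : P.real (A (n+1)) * (2 * c / κ) ≤ ∫ ω in A (n+1), V (n+1) ω ∂P := by
    have := setIntegral_mono_on (μ := P) (s := A (n+1)) (f := fun _ => 2 * c / κ) (g := V (n+1))
      (integrable_const _).integrableOn (hI _).integrableOn (hAm' _)
      (fun ω hω => hω (n+1) (by omega) le_rfl)
    simpa using this
  have h2 := hmk.trans (key n)
  change P (A (n+1)) ≤ _
  rw [← ofReal_measureReal]
  refine ENNReal.ofReal_le_ofReal ?_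
  have h3 := mul_le_mul_of_nonneg_left h2 (by positivity : 0 ≤ κ / (2 * c))
  refine le_trans (le_of_eq ?_) h3
  field_simp

theorem aux_point {Ω E : Type} (K : Set (E × E)) (Ψ : ℕ → Ω → E × E) (β ζ : ℝ) (hβ : 0 < β)
    (hβ1 : β < 1) (hζ : 0 < ζ) (ω : Ω) :
    geomVal β ζ (hitTime K Ψ ω) ≤ ∑' n : ℕ, ENNReal.ofReal ((β ^ (-ζ)) ^ (n+1)) *
      {ω | ∀ k, 1 ≤ k → k ≤ n → Ψ k ω ∉ K}.indicator 1 ω := by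
  have hr : 1 ≤ β ^ (-ζ) := Real.one_le_rpow_of_pos_of_le_one_of_nonpos hβ hβ1.le (by linarith)
  by_cases h : ∃ m : ℕ, 1 ≤ m ∧ Ψ m ω ∈ K
  · obtain ⟨hm1, hmK⟩ := Nat.find_spec h
    set m := Nat.find h with hm
    have hmin : ∀ k, 1 ≤ k → k < m → Ψ k ω ∉ K := fun k h1 h2 h3 => Nat.find_min h h2 ⟨h1, h3⟩
    have hht : hitTime K Ψ ω = (m : ℕ∞) := by
      refine le_antisymm (sInf_le ⟨m, rfl, hm1, hmK⟩) (le_sInf ?_)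
      rintro _ ⟨k, rfl, h1, h2⟩
      exact_mod_cast Nat.find_min' h ⟨h1, h2⟩
    rw [hht]
    refine le_trans ?_ (ENNReal.le_tsum (m-1))
    have : ω ∈ {ω | ∀ k, 1 ≤ k → k ≤ m - 1 → Ψ k ω ∉ K} := fun k h1 h2 => hmin k h1 (by omega)
    rw [indicator_of_mem this, Nat.sub_add_cancel hm1]
    change ENNReal.ofReal (β ^ (-(ζ * (m : ℝ)))) ≤ _
    rw [← neg_mul, Real.rpow_mul hβ.le, Real.rpow_natCast]
    simp
  · push Not at h
    have : ∀ n : ℕ, (1 : ℝ≥0∞) ≤ ENNReal.ofReal ((β ^ (-ζ)) ^ (n+1)) *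
      {ω | ∀ k, 1 ≤ k → k ≤ n → Ψ k ω ∉ K}.indicator 1 ω := by
      intro n
      rw [indicator_of_mem (show ω ∈ {ω | ∀ k, 1 ≤ k → k ≤ n → Ψ k ω ∉ K} from fun k h1 _ => h k h1)]
      simpa using one_le_pow₀ hr
    refine le_trans le_top (le_trans (le_of_eq ?_) (ENNReal.tsum_le_tsum this))
    rw [ENNReal.tsum_const_eq_top_of_ne_zero one_ne_zero]

/-- Exponential moment of the first visit to
`K_ϰ = {V̄ < 2c/ϰ}` for an adapted process with the Lyapunov drift condition
`E(V̄(Ψ_{n+1})|F_n) ≤ Λ₁ V̄(Ψ_n) + 2c`: there are constants `C₁, C₂ > 0`, depending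
only on `Λ₁, ϰ, ζ` and `c`, such that `E((Λ₁+ϰ)^(−ζ d)) ≤ C₁ V̄(x₀,y₀) + C₂`;
in particular `d < ∞` almost surely. -/
theorem hitting_time_exponential_moment
    (Lambda1 c ϰ ζ : ℝ)
    (hL1 : Lambda1 ∈ Ico (0:ℝ) 1) (hc : 0 < c)
    (hϰ : ϰ ∈ Ioo (0:ℝ) (1 - Lambda1)) (hζ : ζ ∈ Ioo (0:ℝ) 1) :
    ∃ C₁ > (0:ℝ), ∃ C₂ > (0:ℝ),
      ∀ (E : Type) (_ : MetricSpace E), ∀ (_ : SecondCountableTopology E)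
        (_ : CompleteSpace E) (mE : MeasurableSpace E), BorelSpace E →
      ∀ (xbar : E) (Ω : Type) (mΩ : MeasurableSpace Ω) (P : Measure Ω),
        IsProbabilityMeasure P →
        ∀ (ℱ : Filtration ℕ mΩ) (Ψ : ℕ → Ω → E × E) (x₀ y₀ : E),
          Adapted ℱ Ψ →
          (∀ᵐ ωp ∂P, Ψ 0 ωp = (x₀, y₀)) →
          (∀ n, Integrable (fun ωp => dist (Ψ n ωp).1 xbar + dist (Ψ n ωp).2 xbar) P) →
          (∀ n, ∀ᵐ ωp ∂P,
            (P[fun ωq => dist (Ψ (n+1) ωq).1 xbar + dist (Ψ (n+1) ωq).2 xbar | ℱ n]) ωp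
              ≤ Lambda1 * (dist (Ψ n ωp).1 xbar + dist (Ψ n ωp).2 xbar) + 2 * c) →
          (∫⁻ ωp, geomVal (Lambda1 + ϰ) ζ
              (hitTime {z : E × E | dist z.1 xbar + dist z.2 xbar < 2 * c / ϰ} Ψ ωp) ∂P)
            ≤ ENNReal.ofReal (C₁ * (dist x₀ xbar + dist y₀ xbar) + C₂) ∧
          ∀ᵐ ωp ∂P,
            hitTime {z : E × E | dist z.1 xbar + dist z.2 xbar < 2 * c / ϰ} Ψ ωp < ⊤ := by
  obtain ⟨hL0, hL1'⟩ := hL1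
  obtain ⟨hκ, hκ1⟩ := hϰ
  obtain ⟨hζ0, hζ1⟩ := hζ
  set β := Lambda1 + ϰ with hβd
  have hβ : 0 < β := by linarith
  have hβ1 : β < 1 := by linarith
  set r := β ^ (-ζ) with hrd
  have hr : 0 < r := Real.rpow_pos_of_pos hβ _
  have hq : r * β < 1 := by
    have : r * β = β ^ (1 - ζ) := by
      rw [hrd, sub_eq_neg_add, Real.rpow_add hβ, Real.rpow_one]
    rw [this]
    exact Real.rpow_lt_one hβ.le hβ1 (by linarith)
  have hq0 : 0 < r * β := by positivity
  have hq1 : 0 < 1 - r * β := by linarith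
  set D := ϰ / (2 * c) * r ^ 2 * (1 - r * β)⁻¹ with hD
  have hD0 : 0 < D := by positivity
  refine ⟨D, hD0, r + 2 * c * D, by positivity, ?_⟩
  intro E _ _ _ mE _ xbar Ω mΩ P _ ℱ Ψ x₀ y₀ hAd h0 hI hd
  set K := {z : E × E | dist z.1 xbar + dist z.2 xbar < 2 * c / ϰ} with hK
  set v0 := dist x₀ xbar + dist y₀ xbar with hv0d
  have hv0 : 0 ≤ v0 := by positivity
  have hW : Measurable (fun z : E × E => dist z.1 xbar + dist z.2 xbar) := by fun_prop
  have htail := aux_tail P ℱ (fun n ω => dist (Ψ n ω).1 xbar + dist (Ψ n ω).2 xbar)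
    Lambda1 c ϰ v0 hL0 hL1' hc hκ (fun n ω => by positivity)
    (fun n => hW.comp (hAd n)) (by filter_upwards [h0] with ω hω; simp [hω, hv0d]) hI hd
  have hKm : MeasurableSet K := hW measurableSet_Iio
  have hΨ : ∀ n, Measurable (Ψ n) := fun n => (hAd n).mono (ℱ.le n) le_rfl
  have hBm : ∀ n : ℕ, MeasurableSet {ω | ∀ k, 1 ≤ k → k ≤ n → Ψ k ω ∉ K} := by
    intro n
    have : {ω | ∀ k, 1 ≤ k → k ≤ n → Ψ k ω ∉ K}
        = ⋂ k, ⋂ (_ : 1 ≤ k), ⋂ (_ : k ≤ n), (Ψ k ⁻¹' K)ᶜ := by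
      ext ω; simp
    rw [this]
    exact MeasurableSet.iInter fun k => MeasurableSet.iInter fun _ => MeasurableSet.iInter fun _ =>
      (hΨ k hKm).compl
  have hdom : ∀ ω, geomVal β ζ (hitTime K Ψ ω) ≤ _ := aux_point K Ψ β ζ hβ hβ1 hζ0
  have hsumI : (∫⁻ ω, ∑' n : ℕ, ENNReal.ofReal ((β ^ (-ζ)) ^ (n+1)) *
      {ω | ∀ k, 1 ≤ k → k ≤ n → Ψ k ω ∉ K}.indicator 1 ω ∂P)
      ≤ ENNReal.ofReal (D * v0 + (r + 2 * c * D)) := by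
    rw [lintegral_tsum (fun n => ((measurable_one.indicator (hBm n)).const_mul _).aemeasurable)]
    have hterm : ∀ n : ℕ, (∫⁻ ω, ENNReal.ofReal ((β ^ (-ζ)) ^ (n+1)) *
      {ω | ∀ k, 1 ≤ k → k ≤ n → Ψ k ω ∉ K}.indicator 1 ω ∂P) =
        ENNReal.ofReal (r ^ (n+1)) * P {ω | ∀ k, 1 ≤ k → k ≤ n → Ψ k ω ∉ K} := by
      intro n
      rw [lintegral_const_mul _ (measurable_one.indicator (hBm n)), lintegral_indicator_one (hBm n)]
    simp_rw [hterm]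
    rw [tsum_eq_zero_add' ENNReal.summable]
    have hgeo : HasSum (fun n : ℕ => ϰ / (2 * c) * r ^ 2 * (v0 + 2 * c) * (r * β) ^ n)
        (D * (v0 + 2 * c)) := by
      have := (hasSum_geometric_of_lt_one hq0.le hq).mul_left (ϰ / (2 * c) * r ^ 2 * (v0 + 2 * c))
      have he : D * (v0 + 2 * c) = ϰ / (2 * c) * r ^ 2 * (v0 + 2 * c) * (1 - r * β)⁻¹ := by
        rw [hD]; ring
      rw [he]
      exact this
    have h1 : ENNReal.ofReal (r ^ (0+1)) * P {ω | ∀ k, 1 ≤ k → k ≤ 0 → Ψ k ω ∉ K}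
        ≤ ENNReal.ofReal r := by
      rw [zero_add, pow_one]
      exact mul_le_of_le_one_right' prob_le_one
    have h2 : ∑' n : ℕ, ENNReal.ofReal (r ^ (n+1+1)) *
        P {ω | ∀ k, 1 ≤ k → k ≤ n+1 → Ψ k ω ∉ K} ≤ ENNReal.ofReal (D * (v0 + 2 * c)) := by
      rw [← hgeo.tsum_eq, ENNReal.ofReal_tsum_of_nonneg (fun n => by positivity) hgeo.summable]
      refine ENNReal.tsum_le_tsum fun n => ?_
      have h3 : P {ω | ∀ k, 1 ≤ k → k ≤ n+1 → Ψ k ω ∉ K}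
          ≤ ENNReal.ofReal (ϰ / (2 * c) * (β ^ n * (v0 + 2 * c))) := by
        refine le_trans (measure_mono ?_) (htail n)
        exact fun ω hω k h1 h2 => not_lt.mp (hω k h1 h2)
      refine (mul_le_mul_right h3 _).trans ?_
      rw [← ENNReal.ofReal_mul (by positivity)]
      refine ENNReal.ofReal_le_ofReal (le_of_eq ?_)
      rw [mul_pow]; ring
    refine (add_le_add h1 h2).trans ?_
    rw [← ENNReal.ofReal_add hr.le (by positivity)]
    exact ENNReal.ofReal_le_ofReal (le_of_eq (by ring))
  refine ⟨(lintegral_mono hdom).trans hsumI, ?_⟩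
  have hfin := ae_lt_top (μ := P) (Measurable.tsum (fun n =>
    ((measurable_one.indicator (hBm n)).const_mul (ENNReal.ofReal ((β ^ (-ζ)) ^ (n+1))))))
    (ne_top_of_le_ne_top ENNReal.ofReal_ne_top hsumI)
  filter_upwards [hfin] with ω hω
  have h5 := (hdom ω).trans_lt hω
  rw [lt_top_iff_ne_top]
  intro h6
  rw [h6] at h5
  exact absurd h5 (by simp [geomVal])

end
end
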